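/- arXiv:1912.00014 — 4 statements merged into one kernel-verified Lean document; each statement's English description precedes it below -/
import Mathlib

section
/- Let x : D → ℝ⁴ be a minimal time-like surface in isothermal coordinates with E < 0, and let y : D → ℝ⁴ satisfy y_u = x_v and y_v = x_u. For each θ ∈ ℝ define x_θ := cosh(θ)·x + sinh(θ)·y. Then x_θ is a minimal time-like surface in isothermal coordinates whose first fundamental form coincides with that of x: ⟨(x_θ)_u,(x_θ)_u⟩ = E, ⟨(x_θ)_u,(x_θ)_v⟩ = 0, and ⟨(x_θ)_v,(x_θ)_v⟩ = −E at every point of D; hence the coordinate-identity map is an isometry between x and x_θ. -/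
noncomputable section

abbrev V4 : Type := Fin 4 → ℝ

/-- The indefinite scalar product of `ℝ⁴₂`. -/
def ip (a b : V4) : ℝ := -(a 0 * b 0) + a 1 * b 1 - a 2 * b 2 + a 3 * b 3

/-- Partial derivative w.r.t. the first variable. -/
def pu {E : Type*} [NormedAddCommGroup E] [NormedSpace ℝ E]
    (f : ℝ × ℝ → E) (p : ℝ × ℝ) : E := fderiv ℝ f p (1, 0)

/-- Partial derivative w.r.t. the second variable. -/
def pv {E : Type*} [NormedAddCommGroup E] [NormedSpace ℝ E]
    (f : ℝ × ℝ → E) (p : ℝ × ℝ) : E := fderiv ℝ f p (0, 1)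

/-- `E`, the first coefficient of the first fundamental form. -/
def Ef (x : ℝ × ℝ → V4) (p : ℝ × ℝ) : ℝ := ip (pu x p) (pu x p)

/-- Normal projection of a vector `w` at the point `p` of the surface `x`:
`w^⊥ = w − (⟨w,x_u⟩/E)·x_u + (⟨w,x_v⟩/E)·x_v`. -/
def nproj (x : ℝ × ℝ → V4) (w : V4) (p : ℝ × ℝ) : V4 :=
  w - (ip w (pu x p) / Ef x p) • pu x p + (ip w (pv x p) / Ef x p) • pv x p

/-- `a = (x_uu)^⊥`. -/
def sffA (x : ℝ × ℝ → V4) (p : ℝ × ℝ) : V4 := nproj x (pu (pu x) p) p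

/-- `b = (x_uv)^⊥`. -/
def sffB (x : ℝ × ℝ → V4) (p : ℝ × ℝ) : V4 := nproj x (pv (pu x) p) p

/-- Determinant of the 4×4 matrix with columns `v1, v2, v3, v4`. -/
def det4 (v1 v2 v3 v4 : V4) : ℝ := (Matrix.of ![v1, v2, v3, v4]).transpose.det

/-- The Gauss curvature `K = (⟨b,b⟩ − ⟨a,a⟩)/E²`. -/
def GaussK (x : ℝ × ℝ → V4) (p : ℝ × ℝ) : ℝ :=
  (ip (sffB x p) (sffB x p) - ip (sffA x p) (sffA x p)) / (Ef x p) ^ 2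

/-- The curvature of the normal connection `ϰ = −2·det[x_u,x_v,a,b]/E³`. -/
def NormK (x : ℝ × ℝ → V4) (p : ℝ × ℝ) : ℝ :=
  -2 * det4 (pu x p) (pv x p) (sffA x p) (sffB x p) / (Ef x p) ^ 3

/-- The hyperbolic Laplacian `Δʰ f = f_uu − f_vv`. -/
def hlap (f : ℝ × ℝ → ℝ) (p : ℝ × ℝ) : ℝ := pu (pu f) p - pv (pv f) p

/-- Time-like surface in isothermal coordinates with `E < 0`. -/
def IsTimelikeIso (D : Set (ℝ × ℝ)) (x : ℝ × ℝ → V4) : Prop :=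
  ∀ p ∈ D, Ef x p < 0 ∧ ip (pv x p) (pv x p) = -(Ef x p) ∧ ip (pu x p) (pv x p) = 0

/-- Minimality: `x_uu − x_vv = 0`. -/
def IsMinimal (D : Set (ℝ × ℝ)) (x : ℝ × ℝ → V4) : Prop :=
  ∀ p ∈ D, pu (pu x) p - pv (pv x) p = 0

/-- Degenerate point: `(⟨a,a⟩+⟨b,b⟩)² = 4⟨a,b⟩²`. -/
def DegeneratePt (x : ℝ × ℝ → V4) (p : ℝ × ℝ) : Prop :=
  (ip (sffA x p) (sffA x p) + ip (sffB x p) (sffB x p)) ^ 2 =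
    4 * (ip (sffA x p) (sffB x p)) ^ 2

/-- Surface of the first type. -/
def FirstType (D : Set (ℝ × ℝ)) (x : ℝ × ℝ → V4) : Prop :=
  ∀ p ∈ D,
    (ip (sffA x p) (sffA x p) + ip (sffB x p) (sffB x p)) ^ 2 -
      4 * (ip (sffA x p) (sffB x p)) ^ 2 > 0 ∧
    ip (sffA x p) (sffA x p) + ip (sffB x p) (sffB x p) > 0

/-- Surface of the second type. -/
def SecondType (D : Set (ℝ × ℝ)) (x : ℝ × ℝ → V4) : Prop :=
  ∀ p ∈ D,
    (ip (sffA x p) (sffA x p) + ip (sffB x p) (sffB x p)) ^ 2 -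
      4 * (ip (sffA x p) (sffB x p)) ^ 2 > 0 ∧
    ip (sffA x p) (sffA x p) + ip (sffB x p) (sffB x p) < 0

/-- Surface of the third type. -/
def ThirdType (D : Set (ℝ × ℝ)) (x : ℝ × ℝ → V4) : Prop :=
  ∀ p ∈ D,
    (ip (sffA x p) (sffA x p) + ip (sffB x p) (sffB x p)) ^ 2 -
      4 * (ip (sffA x p) (sffB x p)) ^ 2 < 0

/-- Canonical coordinates with parameters `(e0, e1)`:
`⟨a,a⟩+⟨b,b⟩ = e0` and `2⟨a,b⟩ = e1` identically. -/
def Canonical (D : Set (ℝ × ℝ)) (x : ℝ × ℝ → V4) (e0 e1 : ℝ) : Prop :=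
  ∀ p ∈ D,
    ip (sffA x p) (sffA x p) + ip (sffB x p) (sffB x p) = e0 ∧
    2 * ip (sffA x p) (sffB x p) = e1

section Partials

variable {E : Type*} [NormedAddCommGroup E] [NormedSpace ℝ E]

theorem Filter.EventuallyEq.pu_eq {f g : ℝ × ℝ → E} {p : ℝ × ℝ} (h : f =ᶠ[nhds p] g) :
    pu f p = pu g p := by
  simp only [pu, h.fderiv_eq]

theorem Filter.EventuallyEq.pv_eq {f g : ℝ × ℝ → E} {p : ℝ × ℝ} (h : f =ᶠ[nhds p] g) :
    pv f p = pv g p := by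
  simp only [pv, h.fderiv_eq]

theorem pu_linearCombination {f g : ℝ × ℝ → E} {p : ℝ × ℝ} (hf : DifferentiableAt ℝ f p)
    (hg : DifferentiableAt ℝ g p) (a b : ℝ) :
    pu (fun q => a • f q + b • g q) p = a • pu f p + b • pu g p :=
  congrArg (· (1, 0))
    ((hf.hasFDerivAt.const_smul a).add (hg.hasFDerivAt.const_smul b)).fderiv

theorem pv_linearCombination {f g : ℝ × ℝ → E} {p : ℝ × ℝ} (hf : DifferentiableAt ℝ f p)
    (hg : DifferentiableAt ℝ g p) (a b : ℝ) :
    pv (fun q => a • f q + b • g q) p = a • pv f p + b • pv g p :=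
  congrArg (· (0, 1))
    ((hf.hasFDerivAt.const_smul a).add (hg.hasFDerivAt.const_smul b)).fderiv

theorem ContDiffAt.differentiableAt_fderiv {f : ℝ × ℝ → E} {p : ℝ × ℝ}
    (hf : ContDiffAt ℝ 2 f p) : DifferentiableAt ℝ (fderiv ℝ f) p :=
  (hf.fderiv_right (m := 1) (by norm_num)).differentiableAt (by norm_num)

theorem ContDiffAt.differentiableAt_pu {f : ℝ × ℝ → E} {p : ℝ × ℝ}
    (hf : ContDiffAt ℝ 2 f p) : DifferentiableAt ℝ (pu f) p :=
  hf.differentiableAt_fderiv.clm_apply (differentiableAt_const _)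

theorem ContDiffAt.differentiableAt_pv {f : ℝ × ℝ → E} {p : ℝ × ℝ}
    (hf : ContDiffAt ℝ 2 f p) : DifferentiableAt ℝ (pv f) p :=
  hf.differentiableAt_fderiv.clm_apply (differentiableAt_const _)

/-- Mixed second partial derivatives of a `C²` map commute. -/
theorem ContDiffAt.pu_pv_eq_pv_pu {f : ℝ × ℝ → E} {p : ℝ × ℝ} (hf : ContDiffAt ℝ 2 f p) :
    pu (pv f) p = pv (pu f) p := by
  have h (v w : ℝ × ℝ) : fderiv ℝ (fun q => fderiv ℝ f q v) p w
      = fderiv ℝ (fderiv ℝ f) p w v := by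
    rw [fderiv_clm_apply hf.differentiableAt_fderiv (differentiableAt_const v)]
    simp
  have hsymm : IsSymmSndFDerivAt ℝ f p := hf.isSymmSndFDerivAt (by simp)
  exact (h _ _).trans ((hsymm.eq _ _).trans (h _ _).symm)

end Partials

theorem ip_comm (a b : V4) : ip a b = ip b a := by
  simp only [ip]
  ring

theorem ip_linearCombination (a b c d : V4) (r s t w : ℝ) :
    ip (r • a + s • b) (t • c + w • d)
      = r * t * ip a c + r * w * ip a d + s * t * ip b c + s * w * ip b d := by
  simp only [ip, Pi.add_apply, Pi.smul_apply, smul_eq_mul]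
  ring

/-- The associated family `x_θ = cosh θ · x + sinh θ · y` consists of
minimal time-like surfaces in isothermal coordinates with the same first fundamental
form as `x`; the coordinate-identity map is an isometry. -/
theorem stmt_3 (D : Set (ℝ × ℝ)) (hD : IsOpen D) (x y : ℝ × ℝ → V4)
    (hx : ContDiffOn ℝ 2 x D) (hy : ContDiffOn ℝ 2 y D)
    (hiso : IsTimelikeIso D x) (hmin : IsMinimal D x)
    (hconj : ∀ p ∈ D, pu y p = pv x p ∧ pv y p = pu x p) (θ : ℝ) :
    IsTimelikeIso D (fun q => Real.cosh θ • x q + Real.sinh θ • y q) ∧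
    IsMinimal D (fun q => Real.cosh θ • x q + Real.sinh θ • y q) ∧
    ∀ p ∈ D,
      Ef (fun q => Real.cosh θ • x q + Real.sinh θ • y q) p = Ef x p ∧
      ip (pu (fun q => Real.cosh θ • x q + Real.sinh θ • y q) p)
         (pv (fun q => Real.cosh θ • x q + Real.sinh θ • y q) p) = 0 ∧
      ip (pv (fun q => Real.cosh θ • x q + Real.sinh θ • y q) p)
         (pv (fun q => Real.cosh θ • x q + Real.sinh θ • y q) p) = -(Ef x p) := by
  have hxp (p) (hp : p ∈ D) : ContDiffAt ℝ 2 x p := hx.contDiffAt (hD.mem_nhds hp)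
  have hyp (p) (hp : p ∈ D) : ContDiffAt ℝ 2 y p := hy.contDiffAt (hD.mem_nhds hp)
  have hu (p) (hp : p ∈ D) : pu (fun q => Real.cosh θ • x q + Real.sinh θ • y q) p
      = Real.cosh θ • pu x p + Real.sinh θ • pv x p := by
    rw [pu_linearCombination ((hxp p hp).differentiableAt (by norm_num))
      ((hyp p hp).differentiableAt (by norm_num)), (hconj p hp).1]
  have hv (p) (hp : p ∈ D) : pv (fun q => Real.cosh θ • x q + Real.sinh θ • y q) p
      = Real.cosh θ • pv x p + Real.sinh θ • pu x p := by
    rw [pv_linearCombination ((hxp p hp).differentiableAt (by norm_num))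
      ((hyp p hp).differentiableAt (by norm_num)), (hconj p hp).2]
  have hform : ∀ p ∈ D,
      Ef (fun q => Real.cosh θ • x q + Real.sinh θ • y q) p = Ef x p ∧
      ip (pu (fun q => Real.cosh θ • x q + Real.sinh θ • y q) p)
         (pv (fun q => Real.cosh θ • x q + Real.sinh θ • y q) p) = 0 ∧
      ip (pv (fun q => Real.cosh θ • x q + Real.sinh θ • y q) p)
         (pv (fun q => Real.cosh θ • x q + Real.sinh θ • y q) p) = -(Ef x p) := by
    intro p hp
    obtain ⟨-, hvv, huv⟩ := hiso p hp
    have hcs := Real.cosh_sq_sub_sinh_sq θ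
    simp only [Ef, hu p hp, hv p hp]
    simp only [Ef] at hvv
    rw [ip_linearCombination, ip_linearCombination, ip_linearCombination, ip_comm (pv x p) (pu x p),
      hvv, huv]
    refine ⟨?_, ?_, ?_⟩
    · linear_combination ip (pu x p) (pu x p) * hcs
    · ring
    · linear_combination -ip (pu x p) (pu x p) * hcs
  refine ⟨fun p hp => ?_, fun p hp => ?_, hform⟩
  · obtain ⟨hE, huv, hvv⟩ := hform p hp
    rw [hE]
    exact ⟨(hiso p hp).1, hvv, huv⟩
  · have hnhds := hD.mem_nhds hp
    rw [(Filter.eventuallyEq_of_mem hnhds hu).pu_eq, (Filter.eventuallyEq_of_mem hnhds hv).pv_eq,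
      pu_linearCombination (hxp p hp).differentiableAt_pu (hxp p hp).differentiableAt_pv,
      pv_linearCombination (hxp p hp).differentiableAt_pv (hxp p hp).differentiableAt_pu,
      (hxp p hp).pu_pv_eq_pv_pu, sub_eq_zero.mp (hmin p hp), sub_self]
end
end

section
/- Let x : D → ℝ⁴ be a smooth minimal time-like surface in isothermal coordinates with E < 0, and set a := (x_uu)^⊥, b := (x_uv)^⊥. Then at every point of D the scalar square of the normal part equals the scalar square of the full second derivative data: ⟨a,a⟩ + ⟨b,b⟩ = ⟨x_uu,x_uu⟩ + ⟨x_uv,x_uv⟩ and ⟨a,b⟩ = ⟨x_uu,x_uv⟩. -/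
noncomputable section

/-- Leibniz rule for the scalar product of `ℝ⁴₂`. -/
lemma fderiv_ip {f g : ℝ × ℝ → V4} {p : ℝ × ℝ} (hf : DifferentiableAt ℝ f p)
    (hg : DifferentiableAt ℝ g p) (w : ℝ × ℝ) :
    fderiv ℝ (fun q => ip (f q) (g q)) p w =
      ip (fderiv ℝ f p w) (g p) + ip (f p) (fderiv ℝ g p w) := by
  have hF := hasFDerivAt_pi'.1 hf.hasFDerivAt
  have hG := hasFDerivAt_pi'.1 hg.hasFDerivAt
  have h := (((((hF 0).mul (hG 0)).neg.add ((hF 1).mul (hG 1))).sub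
    ((hF 2).mul (hG 2))).add ((hF 3).mul (hG 3)))
  have h' : HasFDerivAt (fun q => ip (f q) (g q)) _ p := h
  rw [h'.fderiv]
  simp [ip]
  ring

/-- Mixed partial derivatives commute. -/
lemma pu_pv_comm {E : Type*} [NormedAddCommGroup E] [NormedSpace ℝ E] {f : ℝ × ℝ → E}
    {p : ℝ × ℝ} (hf : ContDiffAt ℝ 2 f p) : pu (pv f) p = pv (pu f) p := by
  have hd : DifferentiableAt ℝ (fderiv ℝ f) p :=
    (hf.fderiv_right (m := 1) (by norm_num)).differentiableAt (by norm_num)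
  have hsymm : IsSymmSndFDerivAt ℝ f p := hf.isSymmSndFDerivAt (by simp)
  have key : ∀ v w : ℝ × ℝ, fderiv ℝ (fun q => fderiv ℝ f q v) p w =
      fderiv ℝ (fderiv ℝ f) p w v := fun v w => by
    rw [fderiv_clm_apply hd (differentiableAt_const v)]
    simp
  exact (key _ _).trans ((hsymm _ _).trans (key _ _).symm)

/-- The scalar product of the normal projections of two vectors. -/
lemma ip_nproj_nproj {x : ℝ × ℝ → V4} {p : ℝ × ℝ} (hE : Ef x p ≠ 0)
    (hv : ip (pv x p) (pv x p) = -Ef x p) (huv : ip (pu x p) (pv x p) = 0) (w z : V4) :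
    ip (nproj x w p) (nproj x z p) = ip w z
      - ip w (pu x p) * ip z (pu x p) / Ef x p + ip w (pv x p) * ip z (pv x p) / Ef x p := by
  have expand : ∀ (P Q : V4) (a b c d : ℝ),
      ip (w - a • P + b • Q) (z - c • P + d • Q) = ip w z
        - c * ip w P + d * ip w Q - a * ip z P + b * ip z Q
        + a * c * ip P P + b * d * ip Q Q - (a * d + b * c) * ip P Q := by
    intro P Q a b c d
    simp only [ip, Pi.add_apply, Pi.sub_apply, Pi.smul_apply, smul_eq_mul]
    ring
  rw [nproj, nproj, expand, hv, huv, show ip (pu x p) (pu x p) = Ef x p from rfl]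
  field_simp
  ring

/-- For a minimal time-like surface in isothermal coordinates, the scalar
squares of the normal projections `a = (x_uu)^⊥`, `b = (x_uv)^⊥` recover those of the
full second derivatives. -/
theorem stmt_6 (D : Set (ℝ × ℝ)) (hD : IsOpen D) (x : ℝ × ℝ → V4)
    (hx : ContDiffOn ℝ (⊤ : ℕ∞) x D) (hiso : IsTimelikeIso D x)
    (hmin : IsMinimal D x) :
    ∀ p ∈ D,
      ip (sffA x p) (sffA x p) + ip (sffB x p) (sffB x p) =
        ip (pu (pu x) p) (pu (pu x) p) + ip (pv (pu x) p) (pv (pu x) p) ∧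
      ip (sffA x p) (sffB x p) = ip (pu (pu x) p) (pv (pu x) p) := by
  intro p hp
  obtain ⟨hE, hv, huv⟩ := hiso p hp
  have hx2 : ContDiffAt ℝ 2 x p :=
    (hx.contDiffAt (hD.mem_nhds hp)).of_le (WithTop.coe_le_coe.2 (le_top : (2 : ℕ∞) ≤ ⊤))
  have hd : DifferentiableAt ℝ (fderiv ℝ x) p :=
    (hx2.fderiv_right (m := 1) (by norm_num)).differentiableAt (by norm_num)
  have hdu : DifferentiableAt ℝ (pu x) p := hd.clm_apply (differentiableAt_const _)
  have hdv : DifferentiableAt ℝ (pv x) p := hd.clm_apply (differentiableAt_const _)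
  have orth : ∀ w : ℝ × ℝ,
      ip (fderiv ℝ (pu x) p w) (pv x p) + ip (pu x p) (fderiv ℝ (pv x) p w) = 0 := by
    intro w
    have h0 : (fun q => ip (pu x q) (pv x q)) =ᶠ[nhds p] fun _ => 0 :=
      Filter.eventually_of_mem (hD.mem_nhds hp) fun q hq => (hiso q hq).2.2
    rw [← fderiv_ip hdu hdv w, h0.fderiv_eq]
    simp
  have ip_comm : ∀ v w : V4, ip v w = ip w v := fun v w => by simp only [ip]; ring
  have hu : ip (pu (pu x) p) (pv x p) = -ip (pv (pu x) p) (pu x p) := by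
    rw [← pu_pv_comm hx2, ip_comm (pu (pv x) p)]
    exact eq_neg_of_add_eq_zero_left (orth (1, 0))
  have hv' : ip (pv (pu x) p) (pv x p) = -ip (pu (pu x) p) (pu x p) := by
    rw [sub_eq_zero.1 (hmin p hp), ip_comm (pv (pv x) p)]
    exact eq_neg_of_add_eq_zero_left (orth (0, 1))
  simp only [sffA, sffB, ip_nproj_nproj hE.ne hv huv, hu, hv']
  constructor <;> ring
end
end

section
/- Let x : D → ℝ⁴ be a smooth minimal time-like surface in isothermal coordinates with E < 0. Then at every point of D: E⁴·(K² − ϰ²) = (⟨a,a⟩ + ⟨b,b⟩)² − 4⟨a,b⟩². Consequently: a point p ∈ D is degenerate if and only if K²(p) = ϰ²(p); the surface is of the first or second type if and only if K² − ϰ² > 0 everywhere; and the surface is of the third type if and only if K² − ϰ² < 0 everywhere. -/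
noncomputable section

theorem ip_nproj_left (x : ℝ × ℝ → V4) (w z : V4) (p : ℝ × ℝ) :
    ip (nproj x w p) z =
      ip w z - ip w (pu x p) / Ef x p * ip (pu x p) z
        + ip w (pv x p) / Ef x p * ip (pv x p) z := by
  simp only [nproj]
  generalize ip w (pu x p) / Ef x p = s
  generalize ip w (pv x p) / Ef x p = t
  simp only [ip, Pi.add_apply, Pi.sub_apply, Pi.smul_apply, smul_eq_mul]
  ring

theorem ip_pu_nproj {x : ℝ × ℝ → V4} {p : ℝ × ℝ} (hE : Ef x p ≠ 0)
    (huv : ip (pu x p) (pv x p) = 0) (w : V4) : ip (pu x p) (nproj x w p) = 0 := by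
  have huu : ip (pu x p) (pu x p) = Ef x p := rfl
  rw [ip_comm, ip_nproj_left, ip_comm (pv x p), huv, huu]
  field_simp
  ring

theorem ip_pv_nproj {x : ℝ × ℝ → V4} {p : ℝ × ℝ} (hE : Ef x p ≠ 0)
    (hvv : ip (pv x p) (pv x p) = -Ef x p)
    (huv : ip (pu x p) (pv x p) = 0) (w : V4) : ip (pv x p) (nproj x w p) = 0 := by
  rw [ip_comm, ip_nproj_left, huv, hvv]
  field_simp
  ring

/-- The squared determinant of four vectors is their Gram determinant. -/
theorem det4_sq (v : Fin 4 → V4) :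
    det4 (v 0) (v 1) (v 2) (v 3) ^ 2 = (Matrix.of fun i j => ip (v i) (v j)).det := by
  have hv : ![v 0, v 1, v 2, v 3] = v := by
    ext i; fin_cases i <;> rfl
  have hG : (Matrix.of fun i j => ip (v i) (v j)) =
      Matrix.of v * Matrix.diagonal ![-1, 1, -1, 1] * (Matrix.of v).transpose := by
    ext i j
    rw [Matrix.mul_apply]
    simp [Matrix.mul_diagonal, Fin.sum_univ_four, ip]
    ring
  rw [det4, hv, hG, Matrix.det_mul, Matrix.det_mul, Matrix.det_diagonal, Matrix.det_transpose]
  simp [Fin.prod_univ_four]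
  ring

/-- Gram determinant of two mutually orthogonal pairs, the first pair being orthogonal. -/
theorem det4_sq_of_orthogonal {u v a b : V4} (huv : ip u v = 0) (hua : ip u a = 0)
    (hub : ip u b = 0) (hva : ip v a = 0) (hvb : ip v b = 0) :
    det4 u v a b ^ 2 = ip u u * ip v v * (ip a a * ip b b - ip a b ^ 2) := by
  have h := det4_sq ![u, v, a, b]
  simp only [Matrix.cons_val] at h
  rw [h]
  simp [Matrix.det_succ_row_zero, Fin.sum_univ_succ, Fin.succAbove, ip_comm v u, ip_comm a u,
    ip_comm b u, ip_comm a v, ip_comm b v, ip_comm b a, huv, hua, hub, hva, hvb]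
  ring

theorem Ef_pow_four_mul_curvature {x : ℝ × ℝ → V4} {p : ℝ × ℝ} (hE : Ef x p ≠ 0)
    (hvv : ip (pv x p) (pv x p) = -Ef x p) (huv : ip (pu x p) (pv x p) = 0) :
    (Ef x p) ^ 4 * (GaussK x p ^ 2 - NormK x p ^ 2) =
      (ip (sffA x p) (sffA x p) + ip (sffB x p) (sffB x p)) ^ 2 -
        4 * (ip (sffA x p) (sffB x p)) ^ 2 := by
  have hdet := det4_sq_of_orthogonal huv (ip_pu_nproj hE huv (pu (pu x) p))
    (ip_pu_nproj hE huv (pv (pu x) p)) (ip_pv_nproj hE hvv huv (pu (pu x) p))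
    (ip_pv_nproj hE hvv huv (pv (pu x) p))
  have huu : ip (pu x p) (pu x p) = Ef x p := rfl
  rw [hvv, huu] at hdet
  change det4 (pu x p) (pv x p) (sffA x p) (sffB x p) ^ 2 = Ef x p * -Ef x p *
    (ip (sffA x p) (sffA x p) * ip (sffB x p) (sffB x p) - ip (sffA x p) (sffB x p) ^ 2) at hdet
  rw [GaussK, NormK, div_pow, div_pow, mul_pow, hdet]
  field_simp
  ring

theorem ContDiffOn.pu {D : Set (ℝ × ℝ)} (hD : IsOpen D) {f : ℝ × ℝ → V4}
    (hf : ContDiffOn ℝ (⊤ : ℕ∞) f D) : ContDiffOn ℝ (⊤ : ℕ∞) (pu f) D :=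
  (hf.fderiv_of_isOpen hD (by simp)).clm_apply contDiffOn_const

theorem ContDiffOn.pv {D : Set (ℝ × ℝ)} (hD : IsOpen D) {f : ℝ × ℝ → V4}
    (hf : ContDiffOn ℝ (⊤ : ℕ∞) f D) : ContDiffOn ℝ (⊤ : ℕ∞) (pv f) D :=
  (hf.fderiv_of_isOpen hD (by simp)).clm_apply contDiffOn_const

theorem ContinuousOn.ip {D : Set (ℝ × ℝ)} {f g : ℝ × ℝ → V4}
    (hf : ContinuousOn f D) (hg : ContinuousOn g D) :
    ContinuousOn (fun p => ip (f p) (g p)) D := by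
  have hf' := continuousOn_pi.1 hf
  have hg' := continuousOn_pi.1 hg
  exact ((((hf' 0).mul (hg' 0)).neg.add ((hf' 1).mul (hg' 1))).sub ((hf' 2).mul (hg' 2))).add
    ((hf' 3).mul (hg' 3))

theorem ContinuousOn.nproj {D : Set (ℝ × ℝ)} {x w : ℝ × ℝ → V4}
    (hu : ContinuousOn (pu x) D) (hv : ContinuousOn (pv x) D) (hw : ContinuousOn w D)
    (hE : ∀ p ∈ D, Ef x p ≠ 0) : ContinuousOn (fun p => nproj x (w p) p) D :=
  (hw.sub (((hw.ip hu).div (hu.ip hu) hE).smul hu)).add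
    (((hw.ip hv).div (hu.ip hu) hE).smul hv)

/-- A continuous nonvanishing real function on a preconnected set has constant sign. -/
theorem IsPreconnected.forall_pos_or_forall_neg {X : Type*} [TopologicalSpace X] {D : Set X}
    (hD : IsPreconnected D) {f : X → ℝ} (hf : ContinuousOn f D) (h0 : ∀ p ∈ D, f p ≠ 0) :
    (∀ p ∈ D, f p > 0) ∨ (∀ p ∈ D, f p < 0) := by
  by_contra! h
  obtain ⟨⟨p, hp, hp'⟩, q, hq, hq'⟩ := h
  obtain ⟨r, hr, hr'⟩ := hD.intermediate_value hp hq hf ⟨hp', hq'⟩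
  exact h0 r hr hr'

/-- `E⁴(K² − ϰ²) = (⟨a,a⟩+⟨b,b⟩)² − 4⟨a,b⟩²`; consequently a point is
degenerate iff `K² = ϰ²` there, the surface is of the first or second type iff
`K² − ϰ² > 0` everywhere, and of the third type iff `K² − ϰ² < 0` everywhere. -/
theorem stmt_7 (D : Set (ℝ × ℝ)) (hD : IsOpen D) (hconn : IsConnected D)
    (x : ℝ × ℝ → V4) (hx : ContDiffOn ℝ (⊤ : ℕ∞) x D)
    (hiso : IsTimelikeIso D x) (hmin : IsMinimal D x) :
    (∀ p ∈ D, (Ef x p) ^ 4 * (GaussK x p ^ 2 - NormK x p ^ 2) =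
      (ip (sffA x p) (sffA x p) + ip (sffB x p) (sffB x p)) ^ 2 -
        4 * (ip (sffA x p) (sffB x p)) ^ 2) ∧
    (∀ p ∈ D, DegeneratePt x p ↔ GaussK x p ^ 2 = NormK x p ^ 2) ∧
    ((FirstType D x ∨ SecondType D x) ↔
      ∀ p ∈ D, GaussK x p ^ 2 - NormK x p ^ 2 > 0) ∧
    (ThirdType D x ↔ ∀ p ∈ D, GaussK x p ^ 2 - NormK x p ^ 2 < 0) := by
  have hE : ∀ p ∈ D, Ef x p ≠ 0 := fun p hp => (hiso p hp).1.ne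
  have key : ∀ p ∈ D, (Ef x p) ^ 4 * (GaussK x p ^ 2 - NormK x p ^ 2) =
      (ip (sffA x p) (sffA x p) + ip (sffB x p) (sffB x p)) ^ 2 -
        4 * (ip (sffA x p) (sffB x p)) ^ 2 := fun p hp =>
    Ef_pow_four_mul_curvature (hE p hp) (hiso p hp).2.1 (hiso p hp).2.2
  have hpos : ∀ p ∈ D, 0 < (Ef x p) ^ 4 := fun p hp => by
    have := hE p hp
    positivity
  have hcont : ContinuousOn
      (fun p => ip (sffA x p) (sffA x p) + ip (sffB x p) (sffB x p)) D := by
    have hu := hx.pu hD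
    have hA : ContinuousOn (sffA x) D :=
      hu.continuousOn.nproj (hx.pv hD).continuousOn (hu.pu hD).continuousOn hE
    have hB : ContinuousOn (sffB x) D :=
      hu.continuousOn.nproj (hx.pv hD).continuousOn (hu.pv hD).continuousOn hE
    exact (hA.ip hA).add (hB.ip hB)
  refine ⟨key, fun p hp => ?_, ⟨fun h p hp => ?_, fun h => ?_⟩, forall₂_congr fun p hp => ?_⟩
  · rw [DegeneratePt, ← sub_eq_zero, ← key p hp, mul_eq_zero, sub_eq_zero]
    simp [(hpos p hp).ne']
  · have h' := h.elim (fun h => (h p hp).1) (fun h => (h p hp).1)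
    rw [← key p hp] at h'
    exact (mul_pos_iff_of_pos_left (hpos p hp)).1 h'
  · have hd : ∀ p ∈ D, (ip (sffA x p) (sffA x p) + ip (sffB x p) (sffB x p)) ^ 2 -
        4 * (ip (sffA x p) (sffB x p)) ^ 2 > 0 := fun p hp => by
      rw [← key p hp]
      exact mul_pos (hpos p hp) (h p hp)
    have h0 : ∀ p ∈ D, ip (sffA x p) (sffA x p) + ip (sffB x p) (sffB x p) ≠ 0 := by
      intro p hp h0
      have := hd p hp
      rw [h0] at this
      nlinarith [sq_nonneg (ip (sffA x p) (sffB x p))]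
    exact (hconn.isPreconnected.forall_pos_or_forall_neg hcont h0).imp
      (fun hs p hp => ⟨hd p hp, hs p hp⟩) (fun hs p hp => ⟨hd p hp, hs p hp⟩)
  · rw [← key p hp]
    exact smul_neg_iff_of_pos_left (hpos p hp)
end
end

section
/- (System of natural equations) Let x : D → ℝ⁴ be a smooth minimal time-like surface in canonical coordinates with parameters (ε₀,ε₁) ∈ {(1,0), (−1,0), (0,1)}. Then K² − ϰ² ≠ 0 at every point of D, and the Gauss curvature K and the normal curvature ϰ satisfy the system of natural equations: |K² − ϰ²|^{1/4} · Δ^h( ln|K² − ϰ²| ) = −8K and |K² − ϰ²|^{1/4} · Δ^h( ln|(K + ϰ)/(K − ϰ)| ) = −4ϰ at every point of D. -/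
noncomputable section

section PartialDerivatives

variable {W W' : Type*} [NormedAddCommGroup W] [NormedSpace ℝ W]
  [NormedAddCommGroup W'] [NormedSpace ℝ W'] {U : Set (ℝ × ℝ)} {f g : ℝ × ℝ → W} {p : ℝ × ℝ}

lemma contDiffOn_pu (hU : IsOpen U) (hf : ContDiffOn ℝ (⊤ : ℕ∞) f U) :
    ContDiffOn ℝ (⊤ : ℕ∞) (pu f) U :=
  (hf.fderiv_of_isOpen hU (m := (⊤ : ℕ∞)) (by simp)).clm_apply contDiffOn_const

lemma contDiffOn_pv (hU : IsOpen U) (hf : ContDiffOn ℝ (⊤ : ℕ∞) f U) :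
    ContDiffOn ℝ (⊤ : ℕ∞) (pv f) U :=
  (hf.fderiv_of_isOpen hU (m := (⊤ : ℕ∞)) (by simp)).clm_apply contDiffOn_const

lemma ContDiffOn.diffAt (hf : ContDiffOn ℝ (⊤ : ℕ∞) f U) (hU : IsOpen U) (hp : p ∈ U) :
    DifferentiableAt ℝ f p :=
  (hf.contDiffAt (hU.mem_nhds hp)).differentiableAt (by simp)

lemma pu_congr (hU : IsOpen U) (h : Set.EqOn f g U) (hp : p ∈ U) : pu f p = pu g p := by
  rw [pu, pu, (h.eventuallyEq_of_mem (hU.mem_nhds hp)).fderiv_eq]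

lemma pv_congr (hU : IsOpen U) (h : Set.EqOn f g U) (hp : p ∈ U) : pv f p = pv g p := by
  rw [pv, pv, (h.eventuallyEq_of_mem (hU.mem_nhds hp)).fderiv_eq]

lemma pv_pu_comm (hU : IsOpen U) (hf : ContDiffOn ℝ (⊤ : ℕ∞) f U) (hp : p ∈ U) :
    pv (pu f) p = pu (pv f) p := by
  have hs : IsSymmSndFDerivAt ℝ f p :=
    (hf.contDiffAt (hU.mem_nhds hp)).isSymmSndFDerivAt (by
      rw [minSmoothness_of_isRCLikeNormedField]
      exact WithTop.coe_le_coe.mpr le_top)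
  have hd : DifferentiableAt ℝ (fderiv ℝ f) p :=
    (hf.fderiv_of_isOpen hU (m := (⊤ : ℕ∞)) (by simp)).diffAt hU hp
  have key : ∀ v w : ℝ × ℝ, fderiv ℝ (fun q => fderiv ℝ f q v) p w
      = fderiv ℝ (fderiv ℝ f) p w v := fun v w => by
    rw [fderiv_clm_apply hd (differentiableAt_const v)]
    simp
  change fderiv ℝ (fun q => fderiv ℝ f q (1, 0)) p (0, 1)
    = fderiv ℝ (fun q => fderiv ℝ f q (0, 1)) p (1, 0)
  rw [key, key]
  exact hs _ _

lemma pu_add (hf : DifferentiableAt ℝ f p) (hg : DifferentiableAt ℝ g p) :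
    pu (fun q => f q + g q) p = pu f p + pu g p := by
  simp [pu, fderiv_fun_add hf hg]

lemma pv_add (hf : DifferentiableAt ℝ f p) (hg : DifferentiableAt ℝ g p) :
    pv (fun q => f q + g q) p = pv f p + pv g p := by
  simp [pv, fderiv_fun_add hf hg]

lemma pu_sub (hf : DifferentiableAt ℝ f p) (hg : DifferentiableAt ℝ g p) :
    pu (fun q => f q - g q) p = pu f p - pu g p := by
  simp [pu, fderiv_fun_sub hf hg]

lemma pv_sub (hf : DifferentiableAt ℝ f p) (hg : DifferentiableAt ℝ g p) :
    pv (fun q => f q - g q) p = pv f p - pv g p := by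
  simp [pv, fderiv_fun_sub hf hg]

lemma pu_clm (L : W →L[ℝ] W') (hf : DifferentiableAt ℝ f p) :
    pu (fun q => L (f q)) p = L (pu f p) := by
  have : HasFDerivAt (fun q => L (f q)) _ p := L.hasFDerivAt.comp p hf.hasFDerivAt
  simp [pu, this.fderiv]

lemma pv_clm (L : W →L[ℝ] W') (hf : DifferentiableAt ℝ f p) :
    pv (fun q => L (f q)) p = L (pv f p) := by
  have : HasFDerivAt (fun q => L (f q)) _ p := L.hasFDerivAt.comp p hf.hasFDerivAt
  simp [pv, this.fderiv]

end PartialDerivatives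

section ScalarFunctions

variable {U : Set (ℝ × ℝ)} {f g : ℝ × ℝ → ℝ} {p : ℝ × ℝ}

lemma pu_mul (hf : DifferentiableAt ℝ f p) (hg : DifferentiableAt ℝ g p) :
    pu (fun q => f q * g q) p = pu f p * g p + f p * pu g p := by
  simp [pu, fderiv_fun_mul hf hg]; ring

lemma pv_mul (hf : DifferentiableAt ℝ f p) (hg : DifferentiableAt ℝ g p) :
    pv (fun q => f q * g q) p = pv f p * g p + f p * pv g p := by
  simp [pv, fderiv_fun_mul hf hg]; ring

lemma pu_inv (hf : DifferentiableAt ℝ f p) (h : f p ≠ 0) :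
    pu (fun q => (f q)⁻¹) p = -pu f p / f p ^ 2 := by
  have : HasFDerivAt (fun q => (f q)⁻¹) _ p :=
    (hasDerivAt_inv h).comp_hasFDerivAt p hf.hasFDerivAt
  simp [pu, this.fderiv]; ring

lemma pv_inv (hf : DifferentiableAt ℝ f p) (h : f p ≠ 0) :
    pv (fun q => (f q)⁻¹) p = -pv f p / f p ^ 2 := by
  have : HasFDerivAt (fun q => (f q)⁻¹) _ p :=
    (hasDerivAt_inv h).comp_hasFDerivAt p hf.hasFDerivAt
  simp [pv, this.fderiv]; ring

lemma pu_log (hf : DifferentiableAt ℝ f p) (h : f p ≠ 0) :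
    pu (fun q => Real.log (f q)) p = pu f p / f p := by
  simp [pu, fderiv.log hf h]; ring

lemma pv_log (hf : DifferentiableAt ℝ f p) (h : f p ≠ 0) :
    pv (fun q => Real.log (f q)) p = pv f p / f p := by
  simp [pv, fderiv.log hf h]; ring

lemma hlap_congr (hU : IsOpen U) (h : Set.EqOn f g U) (hp : p ∈ U) : hlap f p = hlap g p := by
  rw [hlap, hlap, pu_congr hU (fun q hq => pu_congr hU h hq) hp,
    pv_congr hU (fun q hq => pv_congr hU h hq) hp]

lemma hlap_add (hU : IsOpen U) (hf : ContDiffOn ℝ (⊤ : ℕ∞) f U) (hg : ContDiffOn ℝ (⊤ : ℕ∞) g U)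
    (hp : p ∈ U) : hlap (fun q => f q + g q) p = hlap f p + hlap g p := by
  rw [hlap, hlap, hlap,
    pu_congr hU (fun q hq => pu_add (hf.diffAt hU hq) (hg.diffAt hU hq)) hp,
    pv_congr hU (fun q hq => pv_add (hf.diffAt hU hq) (hg.diffAt hU hq)) hp,
    pu_add ((contDiffOn_pu hU hf).diffAt hU hp) ((contDiffOn_pu hU hg).diffAt hU hp),
    pv_add ((contDiffOn_pv hU hf).diffAt hU hp) ((contDiffOn_pv hU hg).diffAt hU hp)]
  ring

lemma hlap_const_mul (hU : IsOpen U) (c : ℝ) (hf : ContDiffOn ℝ (⊤ : ℕ∞) f U) (hp : p ∈ U) :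
    hlap (fun q => c * f q) p = c * hlap f p := by
  have h1 : ∀ {g : ℝ × ℝ → ℝ}, ContDiffOn ℝ (⊤ : ℕ∞) g U → ∀ q ∈ U,
      pu (fun q => c * g q) q = c * pu g q := fun hg q hq => by
    simp [pu, fderiv_const_mul (hg.diffAt hU hq)]
  have h2 : ∀ {g : ℝ × ℝ → ℝ}, ContDiffOn ℝ (⊤ : ℕ∞) g U → ∀ q ∈ U,
      pv (fun q => c * g q) q = c * pv g q := fun hg q hq => by
    simp [pv, fderiv_const_mul (hg.diffAt hU hq)]
  rw [hlap, hlap, pu_congr hU (h1 hf) hp, pv_congr hU (h2 hf) hp,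
    h1 (contDiffOn_pu hU hf) p hp, h2 (contDiffOn_pv hU hf) p hp]
  ring

/-- A travelling wave on `U`: a smooth solution of `f_v = σ f_u`. -/
structure IsWave (σ : ℝ) (U : Set (ℝ × ℝ)) (f : ℝ × ℝ → ℝ) : Prop where
  smooth : ContDiffOn ℝ (⊤ : ℕ∞) f U
  pv_eq : ∀ q ∈ U, pv f q = σ * pu f q

namespace IsWave

variable {σ : ℝ}

lemma const (c : ℝ) : IsWave σ U (fun _ => c) :=
  ⟨contDiffOn_const, fun q _ => by simp [pu, pv]⟩

lemma mul (hU : IsOpen U) (hf : IsWave σ U f) (hg : IsWave σ U g) :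
    IsWave σ U (fun q => f q * g q) := by
  refine ⟨hf.smooth.mul hg.smooth, fun q hq => ?_⟩
  have h1 := hf.smooth.diffAt hU hq
  have h2 := hg.smooth.diffAt hU hq
  rw [pu_mul h1 h2, pv_mul h1 h2, hf.pv_eq q hq, hg.pv_eq q hq]
  ring

lemma inv (hU : IsOpen U) (hf : IsWave σ U f) (h0 : ∀ q ∈ U, f q ≠ 0) :
    IsWave σ U (fun q => (f q)⁻¹) := by
  refine ⟨hf.smooth.inv h0, fun q hq => ?_⟩
  have h1 := hf.smooth.diffAt hU hq
  rw [pu_inv h1 (h0 q hq), pv_inv h1 (h0 q hq), hf.pv_eq q hq]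
  ring

lemma log (hU : IsOpen U) (hf : IsWave σ U f) (h0 : ∀ q ∈ U, f q ≠ 0) :
    IsWave σ U (fun q => Real.log (f q)) := by
  refine ⟨hf.smooth.log h0, fun q hq => ?_⟩
  have h1 := hf.smooth.diffAt hU hq
  rw [pu_log h1 (h0 q hq), pv_log h1 (h0 q hq), hf.pv_eq q hq]
  ring

lemma deriv (hU : IsOpen U) (hf : IsWave σ U f) : IsWave σ U (pu f) := by
  refine ⟨contDiffOn_pu hU hf.smooth, fun q hq => ?_⟩
  rw [pv_pu_comm hU hf.smooth hq, pu_congr hU hf.pv_eq hq, pu,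
    fderiv_const_mul ((contDiffOn_pu hU hf.smooth).diffAt hU hq)]
  rfl

lemma hlap_eq_zero (hU : IsOpen U) (hσ : σ ^ 2 = 1) (hf : IsWave σ U f) (hp : p ∈ U) :
    hlap f p = 0 := by
  have h1 : pv (pv f) p = σ * pv (pu f) p := by
    rw [pv_congr hU hf.pv_eq hp]
    simp [pv, fderiv_const_mul ((contDiffOn_pu hU hf.smooth).diffAt hU hp)]
  rw [hlap, h1, (hf.deriv hU).pv_eq p hp]
  linear_combination (-pu (pu f) p) * hσ

lemma hlap_log_sub (hU : IsOpen U) (hf : IsWave 1 U f) (hg : IsWave (-1) U g)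
    (h0 : ∀ q ∈ U, f q - g q ≠ 0) (hp : p ∈ U) :
    hlap (fun q => Real.log (f q - g q)) p = 4 * pu f p * pu g p / (f p - g p) ^ 2 := by
  have df := fun q hq => hf.smooth.diffAt (p := q) hU hq
  have dg := fun q hq => hg.smooth.diffAt (p := q) hU hq
  have df' := (hf.deriv hU).smooth.diffAt hU hp
  have dg' := (hg.deriv hU).smooth.diffAt hU hp
  have ds := (df p hp).fun_sub (dg p hp)
  have h1 : Set.EqOn (pu fun q => Real.log (f q - g q))
      (fun q => (pu f q - pu g q) * (f q - g q)⁻¹) U := fun q hq => by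
    rw [pu_log ((df q hq).fun_sub (dg q hq)) (h0 q hq), pu_sub (df q hq) (dg q hq)]
    rfl
  have h2 : Set.EqOn (pv fun q => Real.log (f q - g q))
      (fun q => (pu f q + pu g q) * (f q - g q)⁻¹) U := fun q hq => by
    rw [pv_log ((df q hq).fun_sub (dg q hq)) (h0 q hq), pv_sub (df q hq) (dg q hq),
      hf.pv_eq q hq, hg.pv_eq q hq]
    ring
  rw [hlap, pu_congr hU h1 hp, pv_congr hU h2 hp,
    pu_mul (df'.fun_sub dg') (ds.fun_inv (h0 p hp)), pv_mul (df'.fun_add dg') (ds.fun_inv (h0 p hp)),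
    pu_inv ds (h0 p hp), pv_inv ds (h0 p hp), pu_sub df' dg', pv_add df' dg',
    pu_sub (df p hp) (dg p hp), pv_sub (df p hp) (dg p hp), hf.pv_eq p hp, hg.pv_eq p hp,
    (hf.deriv hU).pv_eq p hp, (hg.deriv hU).pv_eq p hp]
  have := h0 p hp
  field_simp
  ring

end IsWave

lemma hlap_wave_combination (hU : IsOpen U) {A B f₁ g₁ f₂ g₂ : ℝ × ℝ → ℝ} (c₁ c₂ : ℝ)
    (hA : IsWave 1 U A) (hB : IsWave (-1) U B)
    (hf₁ : IsWave 1 U f₁) (hg₁ : IsWave (-1) U g₁) (hf₂ : IsWave 1 U f₂) (hg₂ : IsWave (-1) U g₂)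
    (h₁ : ∀ q ∈ U, f₁ q - g₁ q ≠ 0) (h₂ : ∀ q ∈ U, f₂ q - g₂ q ≠ 0) (hp : p ∈ U) :
    hlap (fun q => (A q + B q) + (c₁ * Real.log (f₁ q - g₁ q) + c₂ * Real.log (f₂ q - g₂ q))) p
      = c₁ * (4 * pu f₁ p * pu g₁ p / (f₁ p - g₁ p) ^ 2)
        + c₂ * (4 * pu f₂ p * pu g₂ p / (f₂ p - g₂ p) ^ 2) := by
  have s₁ := (hf₁.smooth.sub hg₁.smooth).log h₁
  have s₂ := (hf₂.smooth.sub hg₂.smooth).log h₂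
  have t₁ := (contDiffOn_const (c := c₁)).mul s₁
  have t₂ := (contDiffOn_const (c := c₂)).mul s₂
  rw [hlap_add hU (hA.smooth.add hB.smooth) (t₁.add t₂) hp, hlap_add hU hA.smooth hB.smooth hp,
    hlap_add hU t₁ t₂ hp, hlap_const_mul hU c₁ s₁ hp, hlap_const_mul hU c₂ s₂ hp,
    hA.hlap_eq_zero hU (by norm_num) hp, hB.hlap_eq_zero hU (by norm_num) hp,
    hf₁.hlap_log_sub hU hg₁ h₁ hp, hf₂.hlap_log_sub hU hg₂ h₂ hp]
  ring

end ScalarFunctions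

/-- Null coordinates of `ℝ⁴₂ ≅ M₂(ℝ)`, twisted by a row shear `x` and a column shear `y`. -/
def nullCoord (x y : ℝ) : Fin 4 → V4 →ₗ[ℝ] ℝ :=
  let e : Fin 4 → V4 →ₗ[ℝ] ℝ := LinearMap.proj
  ![(e 1 + e 0) + x • (e 2 - e 3) + y • ((e 3 + e 2) + x • (e 1 - e 0)),
    (e 2 - e 3) + y • (e 1 - e 0),
    (e 3 + e 2) + x • (e 1 - e 0),
    e 1 - e 0]

lemma ip_eq_nullCoord (x y : ℝ) (a b : V4) :
    ip a b = (nullCoord x y 0 a * nullCoord x y 3 b + nullCoord x y 3 a * nullCoord x y 0 b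
      - nullCoord x y 1 a * nullCoord x y 2 b - nullCoord x y 2 a * nullCoord x y 1 b) / 2 := by
  simp [ip, nullCoord]
  ring

lemma det4_expand (a b c d : V4) : det4 a b c d =
    (a 0 * b 1 - a 1 * b 0) * (c 2 * d 3 - c 3 * d 2)
    - (a 0 * b 2 - a 2 * b 0) * (c 1 * d 3 - c 3 * d 1)
    + (a 0 * b 3 - a 3 * b 0) * (c 1 * d 2 - c 2 * d 1)
    + (a 1 * b 2 - a 2 * b 1) * (c 0 * d 3 - c 3 * d 0)
    - (a 1 * b 3 - a 3 * b 1) * (c 0 * d 2 - c 2 * d 0)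
    + (a 2 * b 3 - a 3 * b 2) * (c 0 * d 1 - c 1 * d 0) := by
  rw [det4, Matrix.det_transpose]
  simp [Matrix.det_succ_row_zero, Fin.sum_univ_succ, Fin.succAbove]
  ring

lemma det4_eq_nullCoord (x y : ℝ) (a b c d : V4) :
    4 * det4 a b c d = det4 (fun i => nullCoord x y i a) (fun i => nullCoord x y i b)
      (fun i => nullCoord x y i c) (fun i => nullCoord x y i d) := by
  simp only [det4_expand]
  simp [nullCoord]
  ring

lemma exists_shear {p q p' q' : ℝ} (h : p ≠ 0 ∨ q ≠ 0) (h' : p' ≠ 0 ∨ q' ≠ 0) :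
    ∃ y : ℝ, p + y * q ≠ 0 ∧ p' + y * q' ≠ 0 := by
  by_contra! H
  have h0 := H 0
  have h1 := H 1
  have h2 := H (-1)
  grind

lemma exists_nullCoord_ne_zero {P Q : V4} (hP : P ≠ 0) (hQ : Q ≠ 0) :
    ∃ x y : ℝ, nullCoord x y 0 P ≠ 0 ∧ nullCoord x y 0 Q ≠ 0 := by
  have key : ∀ R : V4, R ≠ 0 → ∃ p q : ℝ, (p ≠ 0 ∨ q ≠ 0) ∧ ∀ x : ℝ, p + x * q ≠ 0 →
      (R 1 + R 0) + x * (R 2 - R 3) ≠ 0 ∨ (R 3 + R 2) + x * (R 1 - R 0) ≠ 0 := by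
    intro R hR
    by_cases h : R 1 + R 0 ≠ 0 ∨ R 2 - R 3 ≠ 0
    · exact ⟨_, _, h, fun x hx => Or.inl hx⟩
    · refine ⟨R 3 + R 2, R 1 - R 0, ?_, fun x hx => Or.inr hx⟩
      by_contra! h'
      push Not at h
      refine hR (funext fun i => ?_)
      fin_cases i <;> simp <;> linarith
  obtain ⟨p, q, hpq, h⟩ := key P hP
  obtain ⟨p', q', hpq', h'⟩ := key Q hQ
  obtain ⟨x, hx, hx'⟩ := exists_shear hpq hpq'
  obtain ⟨y, hy, hy'⟩ := exists_shear (h x hx) (h' x hx')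
  exact ⟨x, y, by simpa [nullCoord, mul_add, add_assoc] using hy,
    by simpa [nullCoord, mul_add, add_assoc] using hy'⟩

lemma null_frame_curvatures {x : ℝ × ℝ → V4} {q : ℝ × ℝ} {P Q P' Q' : V4}
    (hu : pu x q = (1 / 2 : ℝ) • (P + Q)) (hv : pv x q = (1 / 2 : ℝ) • (P - Q))
    (huu : pu (pu x) q = (1 / 2 : ℝ) • (P' + Q')) (huv : pv (pu x) q = (1 / 2 : ℝ) • (P' - Q'))
    (hP : ip P P = 0) (hQ : ip Q Q = 0) (hP' : ip P' P = 0) (hQ' : ip Q' Q = 0)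
    (hE : ip P Q ≠ 0) :
    Ef x q = ip P Q / 2 ∧
    GaussK x q = -4 * (ip P' Q' * ip P Q - ip P' Q * ip Q' P) / ip P Q ^ 3 ∧
    NormK x q = -4 * det4 P Q P' Q' / ip P Q ^ 3 ∧
    ip (sffA x q) (sffA x q) + ip (sffB x q) (sffB x q) + 2 * ip (sffA x q) (sffB x q)
      = ip P' P' ∧
    ip (sffA x q) (sffA x q) + ip (sffB x q) (sffB x q) - 2 * ip (sffA x q) (sffB x q)
      = ip Q' Q' := by
  have hsymm : ∀ a b, ip a b = ip b a := fun a b => by simp only [ip]; ring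
  have hadd : ∀ a b c, ip (a + b) c = ip a c + ip b c := fun a b c => by simp [ip]; ring
  have hsub : ∀ a b c, ip (a - b) c = ip a c - ip b c := fun a b c => by simp [ip]; ring
  have hsmul : ∀ (r : ℝ) a c, ip (r • a) c = r * ip a c := fun r a c => by simp [ip]; ring
  have hadd' : ∀ a b c, ip c (a + b) = ip c a + ip c b := fun a b c => by simp [ip]; ring
  have hsub' : ∀ a b c, ip c (a - b) = ip c a - ip c b := fun a b c => by simp [ip]; ring
  have hsmul' : ∀ (r : ℝ) a c, ip c (r • a) = r * ip c a := fun r a c => by simp [ip]; ring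
  have hEf : Ef x q = ip P Q / 2 := by
    rw [Ef, hu]
    simp only [hadd, hsmul, hadd', hsmul', hP, hQ, hsymm Q P]
    ring
  have hA : sffA x q = (1 / 2 : ℝ) • ((P' - (ip P' Q / ip P Q) • P)
      + (Q' - (ip Q' P / ip P Q) • Q)) := by
    rw [sffA, nproj, huu, hu, hv, hEf]
    simp only [hadd, hsmul, hadd', hsub', hsmul', hP', hQ']
    ext i
    simp
    field_simp
    ring
  have hB : sffB x q = (1 / 2 : ℝ) • ((P' - (ip P' Q / ip P Q) • P)
      - (Q' - (ip Q' P / ip P Q) • Q)) := by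
    rw [sffB, nproj, huv, hu, hv, hEf]
    simp only [hsub, hsmul, hadd', hsub', hsmul', hP', hQ']
    ext i
    simp
    field_simp
    ring
  have sP : ip P P' = 0 := hsymm P P' ▸ hP'
  have sQ : ip Q Q' = 0 := hsymm Q Q' ▸ hQ'
  refine ⟨hEf, ?_, ?_, ?_, ?_⟩
  · rw [GaussK, hA, hB, hEf]
    simp only [hadd, hsub, hsmul, hadd', hsub', hsmul', hP, hQ, hP', hQ', sP, sQ,
      hsymm Q P, hsymm Q' P', hsymm Q P', hsymm P Q']
    field_simp
    ring
  · have hdet : det4 (pu x q) (pv x q) (sffA x q) (sffB x q) = det4 P Q P' Q' / 4 := by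
      rw [hu, hv, hA, hB]
      generalize ip P' Q / ip P Q = α
      generalize ip Q' P / ip P Q = β
      simp only [det4_expand]
      simp
      ring
    rw [NormK, hdet, hEf]
    field_simp
    ring
  · rw [hA, hB]
    simp only [hadd, hsub, hsmul, hadd', hsub', hsmul', hP, hQ, hP', hQ', sP, sQ,
      hsymm Q P, hsymm Q' P', hsymm Q P', hsymm P Q']
    field_simp
    ring
  · rw [hA, hB]
    simp only [hadd, hsub, hsmul, hadd', hsub', hsmul', hP, hQ, hP', hQ', sP, sQ,
      hsymm Q P, hsymm Q' P', hsymm Q P', hsymm P Q']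
    field_simp
    ring

/-- `P`, `P'` are the vectors with null coordinates `f (1, g, h, g h)` and its derivative. -/
structure IsSpinor (x y : ℝ) (P P' : V4) (f g h f' g' h' : ℝ) : Prop where
  c0 : nullCoord x y 0 P = f
  c1 : nullCoord x y 1 P = f * g
  c2 : nullCoord x y 2 P = f * h
  c3 : nullCoord x y 3 P = f * g * h
  d0 : nullCoord x y 0 P' = f'
  d1 : nullCoord x y 1 P' = f' * g + f * g'
  d2 : nullCoord x y 2 P' = f' * h + f * h'
  d3 : nullCoord x y 3 P' = f' * g * h + f * g' * h + f * g * h'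

lemma spinor_curvatures {x : ℝ × ℝ → V4} {q : ℝ × ℝ} {P Q P' Q' : V4}
    {r s f g h f' g' h' F G H F' G' H' : ℝ}
    (hu : pu x q = (1 / 2 : ℝ) • (P + Q)) (hv : pv x q = (1 / 2 : ℝ) • (P - Q))
    (huu : pu (pu x) q = (1 / 2 : ℝ) • (P' + Q')) (huv : pv (pu x) q = (1 / 2 : ℝ) • (P' - Q'))
    (hP : IsSpinor r s P P' f g h f' g' h') (hQ : IsSpinor r s Q Q' F G H F' G' H')
    (hE : Ef x q ≠ 0) :
    Ef x q = f * F * (g - G) * (h - H) / 4 ∧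
    GaussK x q + NormK x q = -16 * (h' * H') / (f * F * (g - G) * (h - H) ^ 3) ∧
    GaussK x q - NormK x q = -16 * (g' * G') / (f * F * (g - G) ^ 3 * (h - H)) ∧
    ip (sffA x q) (sffA x q) + ip (sffB x q) (sffB x q) + 2 * ip (sffA x q) (sffB x q)
      = -(f ^ 2 * g' * h') ∧
    ip (sffA x q) (sffA x q) + ip (sffB x q) (sffB x q) - 2 * ip (sffA x q) (sffB x q)
      = -(F ^ 2 * G' * H') := by
  obtain ⟨c0, c1, c2, c3, d0, d1, d2, d3⟩ := hP
  obtain ⟨C0, C1, C2, C3, D0, D1, D2, D3⟩ := hQ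
  have hEf : Ef x q = f * F * (g - G) * (h - H) / 4 := by
    rw [Ef, hu, ip_eq_nullCoord r s]
    simp only [map_smul, map_add, smul_eq_mul, c0, c1, c2, c3, C0, C1, C2, C3]
    ring
  have hf : f ≠ 0 := fun h0 => hE (by rw [hEf, h0]; ring)
  have hF : F ≠ 0 := fun h0 => hE (by rw [hEf, h0]; ring)
  have hg : g - G ≠ 0 := fun h0 => hE (by rw [hEf, h0]; ring)
  have hh : h - H ≠ 0 := fun h0 => hE (by rw [hEf, h0]; ring)
  have hPQ : ip P Q = f * F * (g - G) * (h - H) / 2 := by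
    rw [ip_eq_nullCoord r s, c0, c1, c2, c3, C0, C1, C2, C3]; ring
  have hPP : ip P P = 0 := by rw [ip_eq_nullCoord r s, c0, c1, c2, c3]; ring
  have hQQ : ip Q Q = 0 := by rw [ip_eq_nullCoord r s, C0, C1, C2, C3]; ring
  have hPP' : ip P' P = 0 := by
    rw [ip_eq_nullCoord r s, c0, c1, c2, c3, d0, d1, d2, d3]; ring
  have hQQ' : ip Q' Q = 0 := by
    rw [ip_eq_nullCoord r s, C0, C1, C2, C3, D0, D1, D2, D3]; ring
  have hdet : det4 P Q P' Q' = f ^ 2 * F ^ 2 *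
      (h' * H' * (g - G) ^ 2 - g' * G' * (h - H) ^ 2) / 4 := by
    have h4 := det4_eq_nullCoord r s P Q P' Q'
    rw [det4_expand (fun i => nullCoord r s i P)] at h4
    simp only [c0, c1, c2, c3, d0, d1, d2, d3, C0, C1, C2, C3, D0, D1, D2, D3] at h4
    linear_combination h4 / 4
  have hK : ip P' Q' * ip P Q - ip P' Q * ip Q' P = f ^ 2 * F ^ 2 *
      (g' * G' * (h - H) ^ 2 + h' * H' * (g - G) ^ 2) / 4 := by
    simp only [ip_eq_nullCoord r s, c0, c1, c2, c3, d0, d1, d2, d3, C0, C1, C2, C3, D0, D1, D2, D3]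
    ring
  obtain ⟨-, e2, e3, e4, e5⟩ := null_frame_curvatures hu hv huu huv hPP hQQ hPP' hQQ'
    (by rw [hPQ]; positivity)
  refine ⟨hEf, ?_, ?_, ?_, ?_⟩
  · rw [e2, e3, hK, hdet, hPQ]
    field_simp
    ring
  · rw [e2, e3, hK, hdet, hPQ]
    field_simp
    ring
  · rw [e4, ip_eq_nullCoord r s, d0, d1, d2, d3]; ring
  · rw [e5, ip_eq_nullCoord r s, D0, D1, D2, D3]; ring

lemma contDiffOn_nullCoord {U : Set (ℝ × ℝ)} {Φ : ℝ × ℝ → V4} (x y : ℝ) (i : Fin 4)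
    (hΦ : ContDiffOn ℝ (⊤ : ℕ∞) Φ U) :
    ContDiffOn ℝ (⊤ : ℕ∞) (fun q => nullCoord x y i (Φ q)) U :=
  (LinearMap.toContinuousLinearMap (nullCoord x y i)).contDiff.comp_contDiffOn hΦ

lemma IsWave.nullCoord {U : Set (ℝ × ℝ)} {Φ : ℝ × ℝ → V4} {σ : ℝ} (hU : IsOpen U) (x y : ℝ)
    (i : Fin 4) (hΦ : ContDiffOn ℝ (⊤ : ℕ∞) Φ U) (hσ : ∀ q ∈ U, pv Φ q = σ • pu Φ q) :
    IsWave σ U (fun q => nullCoord x y i (Φ q)) := by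
  refine ⟨contDiffOn_nullCoord x y i hΦ, fun q hq => ?_⟩
  have hd := hΦ.diffAt hU hq
  have h1 := pu_clm (LinearMap.toContinuousLinearMap (_root_.nullCoord x y i)) hd
  have h2 := pv_clm (LinearMap.toContinuousLinearMap (_root_.nullCoord x y i)) hd
  simp only [LinearMap.coe_toContinuousLinearMap'] at h1 h2
  rw [h1, h2, hσ q hq, map_smul, smul_eq_mul]

lemma exists_spinor_waves {U : Set (ℝ × ℝ)} {Φ : ℝ × ℝ → V4} {σ x y : ℝ} (hU : IsOpen U)
    (hΦ : ContDiffOn ℝ (⊤ : ℕ∞) Φ U) (hσ : ∀ q ∈ U, pv Φ q = σ • pu Φ q)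
    (hnull : ∀ q ∈ U, ip (Φ q) (Φ q) = 0) (h0 : ∀ q ∈ U, nullCoord x y 0 (Φ q) ≠ 0) :
    ∃ f g h : ℝ × ℝ → ℝ, IsWave σ U f ∧ IsWave σ U g ∧ IsWave σ U h ∧
      ∀ q ∈ U, IsSpinor x y (Φ q) (pu Φ q) (f q) (g q) (h q) (pu f q) (pu g q) (pu h q) := by
  have hw := fun i => IsWave.nullCoord hU x y i hΦ hσ
  have hinv := (hw 0).inv hU h0
  have hpu : ∀ i, ∀ q ∈ U, nullCoord x y i (pu Φ q) = pu (fun q => nullCoord x y i (Φ q)) q :=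
    fun i q hq => (pu_clm (LinearMap.toContinuousLinearMap (nullCoord x y i))
      (hΦ.diffAt hU hq)).symm
  obtain ⟨f, hf⟩ : ∃ f : ℝ × ℝ → ℝ, f = fun q => nullCoord x y 0 (Φ q) := ⟨_, rfl⟩
  obtain ⟨g, hg⟩ : ∃ g : ℝ × ℝ → ℝ,
    g = fun q => nullCoord x y 1 (Φ q) * (nullCoord x y 0 (Φ q))⁻¹ := ⟨_, rfl⟩
  obtain ⟨h, hh⟩ : ∃ h : ℝ × ℝ → ℝ,
    h = fun q => nullCoord x y 2 (Φ q) * (nullCoord x y 0 (Φ q))⁻¹ := ⟨_, rfl⟩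
  have wf : IsWave σ U f := hf ▸ hw 0
  have wg : IsWave σ U g := hg ▸ (hw 1).mul hU hinv
  have wh : IsWave σ U h := hh ▸ (hw 2).mul hU hinv
  have c0 : Set.EqOn (fun q => nullCoord x y 0 (Φ q)) f U := fun q _ => by rw [hf]
  have c1 : Set.EqOn (fun q => nullCoord x y 1 (Φ q)) (fun q => f q * g q) U := fun q hq => by
    have := h0 q hq
    simp only [hf, hg]
    field_simp
  have c2 : Set.EqOn (fun q => nullCoord x y 2 (Φ q)) (fun q => f q * h q) U := fun q hq => by
    have := h0 q hq
    simp only [hf, hh]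
    field_simp
  have c3 : Set.EqOn (fun q => nullCoord x y 3 (Φ q)) (fun q => f q * g q * h q) U :=
      fun q hq => by
    have h1 := hnull q hq
    rw [ip_eq_nullCoord x y] at h1
    have := h0 q hq
    simp only [hf, hg, hh]
    field_simp
    linarith
  refine ⟨f, g, h, wf, wg, wh, fun q hq => ?_⟩
  have df := wf.smooth.diffAt hU hq
  have dg := wg.smooth.diffAt hU hq
  have dh := wh.smooth.diffAt hU hq
  refine ⟨c0 hq, c1 hq, c2 hq, c3 hq, ?_, ?_, ?_, ?_⟩
  · rw [hpu 0 q hq, pu_congr hU c0 hq]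
  · rw [hpu 1 q hq, pu_congr hU c1 hq, pu_mul df dg]
  · rw [hpu 2 q hq, pu_congr hU c2 hq, pu_mul df dh]
  · rw [hpu 3 q hq, pu_congr hU c3 hq, pu_mul (df.fun_mul dg) dh, pu_mul df dg]
    ring

/-- The system of natural equations. In canonical coordinates
`K² − ϰ² ≠ 0` and
`|K² − ϰ²|^{1/4}·Δʰ(ln|K² − ϰ²|) = −8K`,
`|K² − ϰ²|^{1/4}·Δʰ(ln|(K+ϰ)/(K−ϰ)|) = −4ϰ`. -/
theorem stmt_13 (D : Set (ℝ × ℝ)) (hD : IsOpen D) (x : ℝ × ℝ → V4)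
    (hx : ContDiffOn ℝ (⊤ : ℕ∞) x D) (hiso : IsTimelikeIso D x) (hmin : IsMinimal D x)
    (e0 e1 : ℝ)
    (hpar : (e0, e1) = (1, 0) ∨ (e0, e1) = (-1, 0) ∨ (e0, e1) = (0, 1))
    (hcan : Canonical D x e0 e1) :
    ∀ p ∈ D,
      GaussK x p ^ 2 - NormK x p ^ 2 ≠ 0 ∧
      |GaussK x p ^ 2 - NormK x p ^ 2| ^ ((1 : ℝ) / 4) *
        hlap (fun s => Real.log |GaussK x s ^ 2 - NormK x s ^ 2|) p =
        -8 * GaussK x p ∧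
      |GaussK x p ^ 2 - NormK x p ^ 2| ^ ((1 : ℝ) / 4) *
        hlap (fun s =>
          Real.log |(GaussK x s + NormK x s) / (GaussK x s - NormK x s)|) p =
        -4 * NormK x p := by

  intro p hp
  have hdu := contDiffOn_pu hD hx
  have hdv := contDiffOn_pv hD hx
  obtain ⟨Φ, hΦ⟩ : ∃ Φ : ℝ × ℝ → V4, Φ = fun q => pu x q + pv x q := ⟨_, rfl⟩
  obtain ⟨Ψ, hΨ⟩ : ∃ Ψ : ℝ × ℝ → V4, Ψ = fun q => pu x q - pv x q := ⟨_, rfl⟩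
  have sΦ : ContDiffOn ℝ (⊤ : ℕ∞) Φ D := hΦ ▸ hdu.add hdv
  have sΨ : ContDiffOn ℝ (⊤ : ℕ∞) Ψ D := hΨ ▸ hdu.sub hdv
  have hvv : ∀ q ∈ D, pv (pv x) q = pu (pu x) q := fun q hq => (sub_eq_zero.mp (hmin q hq)).symm
  have hΦu : ∀ q ∈ D, pu Φ q = pu (pu x) q + pv (pu x) q := fun q hq => by
    rw [hΦ, pu_add (hdu.diffAt hD hq) (hdv.diffAt hD hq), pv_pu_comm hD hx hq]
  have hΨu : ∀ q ∈ D, pu Ψ q = pu (pu x) q - pv (pu x) q := fun q hq => by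
    rw [hΨ, pu_sub (hdu.diffAt hD hq) (hdv.diffAt hD hq), pv_pu_comm hD hx hq]
  have hΦv : ∀ q ∈ D, pv Φ q = (1 : ℝ) • pu Φ q := fun q hq => by
    rw [hΦu q hq, hΦ, pv_add (hdu.diffAt hD hq) (hdv.diffAt hD hq), hvv q hq, one_smul, add_comm]
  have hΨv : ∀ q ∈ D, pv Ψ q = (-1 : ℝ) • pu Ψ q := fun q hq => by
    rw [hΨu q hq, hΨ, pv_sub (hdu.diffAt hD hq) (hdv.diffAt hD hq), hvv q hq, neg_one_smul,
      neg_sub]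
  have hE0 : ∀ q ∈ D, Ef x q ≠ 0 := fun q hq => (hiso q hq).1.ne
  have hΦΦ : ∀ q ∈ D, ip (Φ q) (Φ q) = 0 := fun q hq => by
    obtain ⟨-, h2, h3⟩ := hiso q hq
    simp only [hΦ, Ef, ip, Pi.add_apply] at h2 h3 ⊢
    linear_combination h2 + 2 * h3
  have hΨΨ : ∀ q ∈ D, ip (Ψ q) (Ψ q) = 0 := fun q hq => by
    obtain ⟨-, h2, h3⟩ := hiso q hq
    simp only [hΨ, Ef, ip, Pi.sub_apply] at h2 h3 ⊢
    linear_combination h2 - 2 * h3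
  have hΦΨ : ∀ q ∈ D, ip (Φ q) (Ψ q) = 2 * Ef x q := fun q hq => by
    obtain ⟨-, h2, h3⟩ := hiso q hq
    simp only [hΦ, hΨ, Ef, ip, Pi.sub_apply, Pi.add_apply] at h2 h3 ⊢
    linear_combination -h2
  obtain ⟨r, s, hr, hs⟩ := exists_nullCoord_ne_zero (P := Φ p) (Q := Ψ p)
    (fun h0 => hE0 p hp (by have := hΦΨ p hp; simp [h0, ip] at this; exact this))
    (fun h0 => hE0 p hp (by have := hΦΨ p hp; simp [h0, ip] at this; exact this))
  obtain ⟨U, hU, hpU, hUD, hUΦ, hUΨ⟩ : ∃ U : Set (ℝ × ℝ), IsOpen U ∧ p ∈ U ∧ U ⊆ D ∧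
      (∀ q ∈ U, nullCoord r s 0 (Φ q) ≠ 0) ∧ (∀ q ∈ U, nullCoord r s 0 (Ψ q) ≠ 0) := by
    have o1 := (contDiffOn_nullCoord r s 0 sΦ).continuousOn.isOpen_inter_preimage hD
      isOpen_compl_singleton (t := {0}ᶜ)
    have o2 := (contDiffOn_nullCoord r s 0 sΨ).continuousOn.isOpen_inter_preimage hD
      isOpen_compl_singleton (t := {0}ᶜ)
    exact ⟨_, o1.inter o2, ⟨⟨hp, hr⟩, hp, hs⟩, fun q hq => hq.1.1, fun q hq => hq.1.2,
      fun q hq => hq.2.2⟩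
  obtain ⟨f, g, h, wf, wg, wh, hP⟩ := exists_spinor_waves hU (sΦ.mono hUD)
    (fun q hq => hΦv q (hUD hq)) (fun q hq => hΦΦ q (hUD hq)) hUΦ
  obtain ⟨F, G, H, wF, wG, wH, hQ⟩ := exists_spinor_waves hU (sΨ.mono hUD)
    (fun q hq => hΨv q (hUD hq)) (fun q hq => hΨΨ q (hUD hq)) hUΨ
  have half : ∀ a b c : V4, c = a + b → (1 / 2 : ℝ) • (c + (a - b)) = a ∧
      (1 / 2 : ℝ) • (c - (a - b)) = b := fun a b c hc => by
    subst hc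
    constructor <;> module
  have key := fun q (hq : q ∈ U) => spinor_curvatures (x := x)
    (half _ _ _ (congrFun hΦ q)).1.symm (half _ _ _ (congrFun hΦ q)).2.symm
    (half _ _ _ (hΦu q (hUD hq))).1.symm (half _ _ _ (hΦu q (hUD hq))).2.symm
    (hP q hq) (by have := hQ q hq; rwa [hΨu q (hUD hq), congrFun hΨ q] at this)
    (hE0 q (hUD hq))
  have hprod : (e0 + e1) * (e0 - e1) = 1 ∨ (e0 + e1) * (e0 - e1) = -1 := by
    simp only [Prod.mk.injEq] at hpar
    rcases hpar with ⟨rfl, rfl⟩ | ⟨rfl, rfl⟩ | ⟨rfl, rfl⟩ <;> norm_num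
  have hprod0 : (e0 + e1) * (e0 - e1) ≠ 0 := by rcases hprod with h | h <;> rw [h] <;> norm_num
  have hc1 : ∀ q ∈ U, e0 + e1 = -(f q ^ 2 * pu g q * pu h q) := fun q hq => by
    rw [← (key q hq).2.2.2.1, (hcan q (hUD hq)).1, (hcan q (hUD hq)).2]
  have hc2 : ∀ q ∈ U, e0 - e1 = -(F q ^ 2 * pu G q * pu H q) := fun q hq => by
    rw [← (key q hq).2.2.2.2, (hcan q (hUD hq)).1, (hcan q (hUD hq)).2]
  have hne : ∀ q ∈ U, f q ≠ 0 ∧ pu g q ≠ 0 ∧ pu h q ≠ 0 ∧ F q ≠ 0 ∧ pu G q ≠ 0 ∧ pu H q ≠ 0 ∧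
      g q - G q ≠ 0 ∧ h q - H q ≠ 0 := fun q hq => by
    have h1 := hprod0
    have h2 := hE0 q (hUD hq)
    rw [hc1 q hq, hc2 q hq] at h1
    rw [(key q hq).1] at h2
    refine ⟨?_, ?_, ?_, ?_, ?_, ?_, ?_, ?_⟩ <;> intro h0 <;> simp [h0] at h1 h2
  have hKN : ∀ q ∈ U, GaussK x q ^ 2 - NormK x q ^ 2
      = (e0 + e1) * (e0 - e1) * ((Ef x q)⁻¹) ^ 4 := fun q hq => by
    obtain ⟨k1, k2, k3, -, -⟩ := key q hq
    obtain ⟨n1, n2, n3, n4, n5, n6, n7, n8⟩ := hne q hq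
    rw [sq_sub_sq, k2, k3, k1, hc1 q hq, hc2 q hq]
    field_simp
    norm_num
  have habs : ∀ q ∈ U, |GaussK x q ^ 2 - NormK x q ^ 2| = ((-Ef x q)⁻¹) ^ 4 := fun q hq => by
    rw [hKN q hq, abs_mul, inv_neg, Even.neg_pow (by decide),
      abs_of_nonneg (show 0 ≤ (Ef x q)⁻¹ ^ 4 by positivity)]
    rcases hprod with h | h <;> rw [h] <;> norm_num
  have hroot : |GaussK x p ^ 2 - NormK x p ^ 2| ^ ((1 : ℝ) / 4) = (-Ef x p)⁻¹ := by
    have hpos : 0 ≤ (-Ef x p)⁻¹ := inv_nonneg.mpr (by linarith [(hiso p hp).1])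
    rw [habs p hpU, one_div]
    exact_mod_cast Real.pow_rpow_inv_natCast hpos (n := 4) (by norm_num)
  have hE := hE0 p hp
  obtain ⟨k1, k2, k3, -, -⟩ := key p hpU
  obtain ⟨n1, n2, n3, n4, n5, n6, n7, n8⟩ := hne p hpU
  have hK : GaussK x p = ((GaussK x p + NormK x p) + (GaussK x p - NormK x p)) / 2 := by ring
  have hN : NormK x p = ((GaussK x p + NormK x p) - (GaussK x p - NormK x p)) / 2 := by ring
  have h₁ : ∀ q ∈ U, g q - G q ≠ 0 := fun q hq => (hne q hq).2.2.2.2.2.2.1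
  have h₂ : ∀ q ∈ U, h q - H q ≠ 0 := fun q hq => (hne q hq).2.2.2.2.2.2.2
  refine ⟨?_, ?_, ?_⟩
  · rw [hKN p hpU]
    exact mul_ne_zero hprod0 (pow_ne_zero _ (inv_ne_zero hE))
  · have wA : IsWave 1 U (fun q => -4 * Real.log (4⁻¹ * f q)) :=
      (IsWave.const (-4)).mul hU (((IsWave.const 4⁻¹).mul hU wf).log hU
        fun q hq => mul_ne_zero (by norm_num) (hne q hq).1)
    have wB : IsWave (-1) U (fun q => -4 * Real.log (F q)) :=
      (IsWave.const (-4)).mul hU (wF.log hU fun q hq => (hne q hq).2.2.2.1)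
    have hlog : Set.EqOn (fun q => Real.log |GaussK x q ^ 2 - NormK x q ^ 2|)
        (fun q => (-4 * Real.log (4⁻¹ * f q) + -4 * Real.log (F q))
          + (-4 * Real.log (g q - G q) + -4 * Real.log (h q - H q))) U := fun q hq => by
      obtain ⟨m1, m2, m3, m4, m5, m6, m7, m8⟩ := hne q hq
      have hEq : Ef x q = 4⁻¹ * f q * F q * (g q - G q) * (h q - H q) := by
        rw [(key q hq).1]; ring
      simp only [habs q hq]
      rw [Real.log_pow, Real.log_inv, Real.log_neg_eq_log, hEq, Real.log_mul (by positivity) m8,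
        Real.log_mul (by positivity) m7, Real.log_mul (by positivity) m4]
      push_cast
      ring
    rw [hroot, hlap_congr hU hlog hpU, hlap_wave_combination hU (-4) (-4) wA wB wg wG wh wH h₁ h₂
      hpU, hK, k2, k3, k1]
    field_simp
    ring
  · have wA : IsWave 1 U (fun q => Real.log (pu h q * (pu g q)⁻¹)) :=
      ((wh.deriv hU).mul hU ((wg.deriv hU).inv hU fun q hq => (hne q hq).2.1)).log hU
        fun q hq => mul_ne_zero (hne q hq).2.2.1 (inv_ne_zero (hne q hq).2.1)
    have wB : IsWave (-1) U (fun q => Real.log (pu H q * (pu G q)⁻¹)) :=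
      ((wH.deriv hU).mul hU ((wG.deriv hU).inv hU fun q hq => (hne q hq).2.2.2.2.1)).log hU
        fun q hq => mul_ne_zero (hne q hq).2.2.2.2.2.1 (inv_ne_zero (hne q hq).2.2.2.2.1)
    have hlog : Set.EqOn
        (fun q => Real.log |(GaussK x q + NormK x q) / (GaussK x q - NormK x q)|)
        (fun q => (Real.log (pu h q * (pu g q)⁻¹) + Real.log (pu H q * (pu G q)⁻¹))
          + (2 * Real.log (g q - G q) + -2 * Real.log (h q - H q))) U := fun q hq => by
      obtain ⟨m1, m2, m3, m4, m5, m6, m7, m8⟩ := hne q hq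
      have hquot : (GaussK x q + NormK x q) / (GaussK x q - NormK x q)
          = (pu h q * (pu g q)⁻¹) * (pu H q * (pu G q)⁻¹) * (g q - G q) ^ 2
            * ((h q - H q)⁻¹) ^ 2 := by
        rw [(key q hq).2.1, (key q hq).2.2.1]
        field_simp
      simp only [Real.log_abs, hquot]
      rw [Real.log_mul (by positivity) (by positivity), Real.log_mul (by positivity) (by positivity),
        Real.log_mul (by positivity) (by positivity), Real.log_pow, Real.log_pow, Real.log_inv]
      push_cast
      ring
    rw [hroot, hlap_congr hU hlog hpU, hlap_wave_combination hU 2 (-2) wA wB wg wG wh wH h₁ h₂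
      hpU, hN, k2, k3, k1]
    field_simp
    ring
end
end
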